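/- arXiv:1701.02289 — 2 statements merged into one kernel-verified Lean document; each statement's English description precedes it below -/
import Mathlib

section
/- Let α, β > −1, s ∈ ℝ, and −∞ < W ≤ W' < ∞ be fixed. Then there exists a constant C > 0 such that Υ_{W,s}^{α,β}(t,θ,φ) ≤ C · Υ_{W',s}^{α,β}(t,θ,φ) for all t ∈ (0,π] and θ, φ ∈ (0,π). -/
open Real Set MeasureTheory

/-- `q(θ,φ,u,v) = 1 − u sin(θ/2) sin(φ/2) − v cos(θ/2) cos(φ/2)`. -/
noncomputable def q (θ φ u v : ℝ) : ℝ :=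
  1 - u * Real.sin (θ / 2) * Real.sin (φ / 2) - v * Real.cos (θ / 2) * Real.cos (φ / 2)

/-- The measure `Π_a` on `[−1,1]`: for `a > −1/2` it has density
`Γ(a+1)/(√π Γ(a+1/2)) (1−u²)^{a−1/2}`, and `Π_{−1/2}` is `(δ_{−1}+δ_1)/2`. -/
noncomputable def jacobiPi (a : ℝ) : Measure ℝ :=
  if a = -(1 / 2) then
    (2 : ENNReal)⁻¹ • (Measure.dirac (-1) + Measure.dirac 1)
  else
    (volume.restrict (Icc (-1 : ℝ) 1)).withDensity
      (fun u => ENNReal.ofReal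
        (Real.Gamma (a + 1) / (Real.sqrt π * Real.Gamma (a + 1 / 2)) * (1 - u ^ 2) ^ (a - 1 / 2)))

/-- `Π_a^K`: equals `Π_{−1/2}` if `K = 0` and `Π_{a+1}` if `K = 1`. -/
noncomputable def jacobiPiK (a : ℝ) (K : ℕ) : Measure ℝ :=
  if K = 0 then jacobiPi (-(1 / 2)) else jacobiPi (a + 1)

/-- The function `Υ_{W,s}^{α,β}(t,θ,φ)`, defined by cases according to the
positions of `α, β` relative to `−1/2`. -/
noncomputable def Ups (α β W s t θ φ : ℝ) : ℝ :=
  if -(1 / 2) ≤ α then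
    if -(1 / 2) ≤ β then
      ∫ u, ∫ v, (t ^ 2 + q θ φ u v) ^ (-(α + β + 3 / 2 + W / 4 + s / 2))
        ∂(jacobiPi β) ∂(jacobiPi α)
    else
      1 + ∑ R ∈ Finset.range 2, ∑ r ∈ Finset.range 3,
        (Real.cos (θ / 2) + Real.cos (φ / 2)) ^ (R * r) *
        ∫ u, ∫ v,
          (t ^ 2 + q θ φ u v) ^ (-(α + β + 3 / 2 + W / 4 + ((R * r : ℕ) : ℝ) / 2 + s / 2))
          ∂(jacobiPiK β R) ∂(jacobiPi α)
  else
    if -(1 / 2) ≤ β then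
      1 + ∑ K ∈ Finset.range 2, ∑ k ∈ Finset.range 3,
        (Real.sin (θ / 2) + Real.sin (φ / 2)) ^ (K * k) *
        ∫ u, ∫ v,
          (t ^ 2 + q θ φ u v) ^ (-(α + β + 3 / 2 + W / 4 + ((K * k : ℕ) : ℝ) / 2 + s / 2))
          ∂(jacobiPi β) ∂(jacobiPiK α K)
    else
      1 + ∑ K ∈ Finset.range 2, ∑ R ∈ Finset.range 2, ∑ k ∈ Finset.range 3, ∑ r ∈ Finset.range 3,
        (Real.sin (θ / 2) + Real.sin (φ / 2)) ^ (K * k) *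
        (Real.cos (θ / 2) + Real.cos (φ / 2)) ^ (R * r) *
        ∫ u, ∫ v,
          (t ^ 2 + q θ φ u v) ^
            (-(α + β + 3 / 2 + W / 4 + ((K * k : ℕ) : ℝ) / 2 + ((R * r : ℕ) : ℝ) / 2 + s / 2))
          ∂(jacobiPiK β R) ∂(jacobiPiK α K)

lemma integrableOn_one_sub_sq_rpow {c : ℝ} (hc : -1 < c) :
    IntegrableOn (fun u : ℝ => (1 - u ^ 2) ^ c) (Icc (-1) 1) := by
  have h₁ : IntegrableOn (fun u : ℝ => (1 - u) ^ c) (Icc (-1) 1) := by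
    have h := (intervalIntegral.intervalIntegrable_rpow' (a := 2) (b := 0) hc).comp_sub_left 1
    norm_num at h
    rwa [intervalIntegrable_iff_integrableOn_Icc_of_le (by norm_num)] at h
  have h₂ : IntegrableOn (fun u : ℝ => (1 + u) ^ c) (Icc (-1) 1) := by
    have h := (intervalIntegral.intervalIntegrable_rpow' (a := 0) (b := 2) hc).comp_add_left 1
    norm_num at h
    rwa [intervalIntegrable_iff_integrableOn_Icc_of_le (by norm_num)] at h
  have h₀ : IntegrableOn (fun _ : ℝ => (1 : ℝ)) (Icc (-1) 1) :=
    integrableOn_const (by simp)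
  refine ((h₀.add h₁).add h₂).mono'
    (by fun_prop : Measurable fun u : ℝ => (1 - u ^ 2) ^ c).aestronglyMeasurable ?_
  filter_upwards [ae_restrict_mem measurableSet_Icc] with u ⟨hu₁, hu₂⟩
  have hsq : 0 ≤ 1 - u ^ 2 := by nlinarith
  have hn₁ : 0 ≤ (1 - u) ^ c := rpow_nonneg (by linarith) c
  have hn₂ : 0 ≤ (1 + u) ^ c := rpow_nonneg (by linarith) c
  rw [norm_of_nonneg (rpow_nonneg hsq c)]
  simp only [Pi.add_apply]
  rcases le_or_gt 0 c with h | h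
  · have := rpow_le_one hsq (by nlinarith) h
    linarith
  · rcases hsq.eq_or_lt with hz | hp
    · rw [← hz, zero_rpow h.ne]
      linarith
    · rcases le_total 0 u with hu | hu
      · have := rpow_le_rpow_of_nonpos (x := 1 - u) (by nlinarith) (by nlinarith) h.le
          (y := 1 - u ^ 2)
        linarith
      · have := rpow_le_rpow_of_nonpos (x := 1 + u) (by nlinarith) (by nlinarith) h.le
          (y := 1 - u ^ 2)
        linarith

lemma isFiniteMeasure_jacobiPi {a : ℝ} (ha : -(1 / 2) ≤ a) : IsFiniteMeasure (jacobiPi a) := by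
  unfold jacobiPi
  split_ifs with h
  · exact Measure.smul_finite _ (by simp)
  · have hlt : -1 < a - 1 / 2 := by
      have := lt_of_le_of_ne ha (Ne.symm h)
      linarith
    exact isFiniteMeasure_withDensity_ofReal
      ((integrableOn_one_sub_sq_rpow hlt).const_mul _).hasFiniteIntegral

lemma ae_mem_Icc_jacobiPi (a : ℝ) : ∀ᵐ u ∂(jacobiPi a), u ∈ Icc (-1 : ℝ) 1 := by
  unfold jacobiPi
  split_ifs
  · refine Measure.ae_smul_measure ?_ _
    rw [ae_add_measure_iff]
    constructor <;> exact (ae_dirac_iff (p := (· ∈ Icc (-1 : ℝ) 1)) measurableSet_Icc).2 (by norm_num)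
  · exact (withDensity_absolutelyContinuous _ _).ae_le (ae_restrict_mem measurableSet_Icc)

lemma isFiniteMeasure_jacobiPiK {a : ℝ} (ha : -1 < a) (K : ℕ) :
    IsFiniteMeasure (jacobiPiK a K) := by
  unfold jacobiPiK
  split_ifs
  · exact isFiniteMeasure_jacobiPi le_rfl
  · exact isFiniteMeasure_jacobiPi (by linarith)

lemma ae_mem_Icc_jacobiPiK (a : ℝ) (K : ℕ) :
    ∀ᵐ u ∂(jacobiPiK a K), u ∈ Icc (-1 : ℝ) 1 := by
  unfold jacobiPiK
  split_ifs <;> exact ae_mem_Icc_jacobiPi _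

lemma q_mem_Icc {θ φ u v : ℝ} (hθ : θ ∈ Ioo 0 π) (hφ : φ ∈ Ioo 0 π)
    (hu : u ∈ Icc (-1 : ℝ) 1) (hv : v ∈ Icc (-1 : ℝ) 1) : q θ φ u v ∈ Icc 0 2 := by
  obtain ⟨hθ₀, hθ₁⟩ := hθ
  obtain ⟨hφ₀, hφ₁⟩ := hφ
  have hs : 0 ≤ Real.sin (θ / 2) * Real.sin (φ / 2) :=
    mul_nonneg (sin_nonneg_of_nonneg_of_le_pi (by linarith) (by linarith))
      (sin_nonneg_of_nonneg_of_le_pi (by linarith) (by linarith))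
  have hc : 0 ≤ Real.cos (θ / 2) * Real.cos (φ / 2) :=
    mul_nonneg (cos_nonneg_of_mem_Icc ⟨by linarith, by linarith⟩)
      (cos_nonneg_of_mem_Icc ⟨by linarith, by linarith⟩)
  have hsub := cos_sub (θ / 2) (φ / 2)
  have hle := cos_le_one (θ / 2 - φ / 2)
  unfold q
  constructor <;> nlinarith [mul_le_mul_of_nonneg_right hu.1 hs, mul_le_mul_of_nonneg_right hu.2 hs,
    mul_le_mul_of_nonneg_right hv.1 hc, mul_le_mul_of_nonneg_right hv.2 hc]

lemma integral_integral_rpow_le {μ ν : Measure ℝ} (hμf : IsFiniteMeasure μ)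
    (hνf : IsFiniteMeasure ν) (hμ : ∀ᵐ u ∂μ, u ∈ Icc (-1 : ℝ) 1)
    (hν : ∀ᵐ v ∂ν, v ∈ Icc (-1 : ℝ) 1) {t θ φ : ℝ} (ht : t ∈ Ioc 0 π) (hθ : θ ∈ Ioo 0 π)
    (hφ : φ ∈ Ioo 0 π) {a b d : ℝ} (hd : 0 ≤ d) (hab : a = b + d) :
    ∫ u, ∫ v, (t ^ 2 + q θ φ u v) ^ a ∂ν ∂μ ≤
      (π ^ 2 + 2) ^ d * ∫ u, ∫ v, (t ^ 2 + q θ φ u v) ^ b ∂ν ∂μ := by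
  have htp : 0 < t ^ 2 := pow_pos ht.1 2
  have htπ : t ^ 2 ≤ π ^ 2 := pow_le_pow_left₀ ht.1.le ht.2 2
  have hmeas : Measurable fun p : ℝ × ℝ => (t ^ 2 + q θ φ p.1 p.2) ^ b := by
    unfold q
    fun_prop
  have hbound : ∀ u ∈ Icc (-1 : ℝ) 1, ∀ v ∈ Icc (-1 : ℝ) 1,
      ‖(t ^ 2 + q θ φ u v) ^ b‖ ≤ (t ^ 2) ^ b + (π ^ 2 + 2) ^ b := by
    intro u hu v hv
    obtain ⟨h₀, h₁⟩ := q_mem_Icc hθ hφ hu hv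
    rw [norm_of_nonneg (rpow_nonneg (by linarith) b)]
    have hp₁ : 0 ≤ (t ^ 2) ^ b := by positivity
    have hp₂ : 0 ≤ (π ^ 2 + 2) ^ b := by positivity
    rcases le_total 0 b with hb | hb
    · have : (t ^ 2 + q θ φ u v) ^ b ≤ (π ^ 2 + 2) ^ b :=
        rpow_le_rpow (by linarith) (by linarith) hb
      linarith
    · have : (t ^ 2 + q θ φ u v) ^ b ≤ (t ^ 2) ^ b :=
        rpow_le_rpow_of_nonpos htp (by linarith) hb
      linarith
  have hprod : Integrable (fun p : ℝ × ℝ => (t ^ 2 + q θ φ p.1 p.2) ^ b) (μ.prod ν) := by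
    refine Integrable.of_bound hmeas.aestronglyMeasurable ((t ^ 2) ^ b + (π ^ 2 + 2) ^ b) ?_
    filter_upwards [Measure.quasiMeasurePreserving_fst.ae hμ,
      Measure.quasiMeasurePreserving_snd.ae hν] with p hp₁ hp₂
    exact hbound _ hp₁ _ hp₂
  rw [← integral_const_mul]
  refine integral_mono_of_nonneg ?_ (hprod.integral_prod_left.const_mul _) ?_
  · filter_upwards [hμ] with u hu
    refine integral_nonneg_of_ae ?_
    filter_upwards [hν] with v hv
    have := (q_mem_Icc hθ hφ hu hv).1
    exact rpow_nonneg (by linarith) a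
  · filter_upwards [hμ] with u hu
    rw [← integral_const_mul]
    refine integral_mono_of_nonneg ?_ (Integrable.const_mul ?_ _) ?_
    · filter_upwards [hν] with v hv
      have := (q_mem_Icc hθ hφ hu hv).1
      exact rpow_nonneg (by linarith) a
    · refine Integrable.of_bound (hmeas.comp measurable_prodMk_left).aestronglyMeasurable
        ((t ^ 2) ^ b + (π ^ 2 + 2) ^ b) ?_
      filter_upwards [hν] with v hv
      exact hbound u hu v hv
    · filter_upwards [hν] with v hv
      obtain ⟨h₀, h₁⟩ := q_mem_Icc hθ hφ hu hv
      have hpos : 0 < t ^ 2 + q θ φ u v := by linarith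
      rw [hab, rpow_add hpos, mul_comm]
      exact mul_le_mul_of_nonneg_right (rpow_le_rpow hpos.le (by linarith) hd)
        (rpow_nonneg hpos.le b)

theorem stmt_7 (α β s W W' : ℝ) (hα : -1 < α) (hβ : -1 < β) (hWW' : W ≤ W') :
    ∃ C : ℝ, 0 < C ∧
      ∀ t θ φ : ℝ, t ∈ Ioc (0 : ℝ) π → θ ∈ Ioo (0 : ℝ) π → φ ∈ Ioo (0 : ℝ) π →
        Ups α β W s t θ φ ≤ C * Ups α β W' s t θ φ := by
  have hd : 0 ≤ (W' - W) / 4 := by linarith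
  have hC : 1 ≤ (π ^ 2 + 2) ^ ((W' - W) / 4) := one_le_rpow (by nlinarith [sq_nonneg π]) hd
  refine ⟨(π ^ 2 + 2) ^ ((W' - W) / 4), by linarith, fun t θ φ ht hθ hφ => ?_⟩
  have hs : 0 ≤ Real.sin (θ / 2) + Real.sin (φ / 2) :=
    add_nonneg (sin_nonneg_of_nonneg_of_le_pi (by linarith [hθ.1]) (by linarith [hθ.1, hθ.2]))
      (sin_nonneg_of_nonneg_of_le_pi (by linarith [hφ.1]) (by linarith [hφ.1, hφ.2]))
  have hc : 0 ≤ Real.cos (θ / 2) + Real.cos (φ / 2) :=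
    add_nonneg (cos_nonneg_of_mem_Icc ⟨by linarith [hθ.1, hθ.2], by linarith [hθ.2]⟩)
      (cos_nonneg_of_mem_Icc ⟨by linarith [hφ.1, hφ.2], by linarith [hφ.2]⟩)
  unfold Ups
  split_ifs with h₁ h₂ h₂
  · exact integral_integral_rpow_le (isFiniteMeasure_jacobiPi h₁) (isFiniteMeasure_jacobiPi h₂)
      (ae_mem_Icc_jacobiPi _) (ae_mem_Icc_jacobiPi _) ht hθ hφ hd (by ring)
  · simp only [mul_add, Finset.mul_sum, mul_one]
    refine add_le_add hC (Finset.sum_le_sum fun R _ => Finset.sum_le_sum fun r _ => ?_)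
    rw [mul_left_comm]
    exact mul_le_mul_of_nonneg_left
      (integral_integral_rpow_le (isFiniteMeasure_jacobiPi h₁) (isFiniteMeasure_jacobiPiK hβ R)
        (ae_mem_Icc_jacobiPi _) (ae_mem_Icc_jacobiPiK _ _) ht hθ hφ hd (by ring))
      (pow_nonneg hc _)
  · simp only [mul_add, Finset.mul_sum, mul_one]
    refine add_le_add hC (Finset.sum_le_sum fun K _ => Finset.sum_le_sum fun k _ => ?_)
    rw [mul_left_comm]
    exact mul_le_mul_of_nonneg_left
      (integral_integral_rpow_le (isFiniteMeasure_jacobiPiK hα K) (isFiniteMeasure_jacobiPi h₂)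
        (ae_mem_Icc_jacobiPiK _ _) (ae_mem_Icc_jacobiPi _) ht hθ hφ hd (by ring))
      (pow_nonneg hs _)
  · simp only [mul_add, Finset.mul_sum, mul_one]
    refine add_le_add hC (Finset.sum_le_sum fun K _ => Finset.sum_le_sum fun R _ =>
      Finset.sum_le_sum fun k _ => Finset.sum_le_sum fun r _ => ?_)
    rw [mul_left_comm]
    exact mul_le_mul_of_nonneg_left
      (integral_integral_rpow_le (isFiniteMeasure_jacobiPiK hα K) (isFiniteMeasure_jacobiPiK hβ R)
        (ae_mem_Icc_jacobiPiK _ _) (ae_mem_Icc_jacobiPiK _ _) ht hθ hφ hd (by ring))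
      (mul_nonneg (pow_nonneg hs _) (pow_nonneg hc _))
end

section
/- Let α, β > −1. Then there exists a constant C > 0 such that for all t ∈ (0,π] and all θ, θ' ∈ (0,π) with |θ−θ'| ≤ t: (1 / V_t^{α,β}(θ)) · ∫_{|η|<t} 1_{{θ+η ∈ (0,π)}} 1_{{θ'+η ≤ 0}} (sin((θ+η)/2))^{2α+1} (cos((θ+η)/2))^{2β+1} dη ≤ C (|θ−θ'|/t)^{2α+2}. -/
open Real Set MeasureTheory

/-- The Jacobi measure `μ_{α,β}` on `(0,π)` with density
`(sin(θ/2))^{2α+1} (cos(θ/2))^{2β+1}`. -/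
noncomputable def jacobiMeasure (α β : ℝ) : Measure ℝ :=
  (volume.restrict (Ioo 0 π)).withDensity
    (fun θ => ENNReal.ofReal ((Real.sin (θ / 2)) ^ (2 * α + 1) * (Real.cos (θ / 2)) ^ (2 * β + 1)))

/-- The ball `B(θ,r) = (θ−r, θ+r) ∩ (0,π)`. -/
def jacobiBall (θ r : ℝ) : Set ℝ := Ioo (θ - r) (θ + r) ∩ Ioo 0 π

/-- `V_t^{α,β}(θ) = μ_{α,β}(B(θ,t))`. -/
noncomputable def V (α β t θ : ℝ) : ℝ := (jacobiMeasure α β (jacobiBall θ t)).toReal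

/-- If `y / x` stays in a compact subinterval of `(0,∞)`, then `y ^ p` is comparable to `x ^ p`. -/
theorem exists_rpow_comparable (p m M : ℝ) (hm : 0 < m) :
    ∃ k K : ℝ, 0 < k ∧ 0 < K ∧ ∀ x y : ℝ, 0 < x → m * x ≤ y → y ≤ M * x →
      k * x ^ p ≤ y ^ p ∧ y ^ p ≤ K * x ^ p := by
  have hm' : 0 < m ^ p := rpow_pos_of_pos hm p
  rcases lt_or_ge M m with hM | hM
  · refine ⟨1, 1, one_pos, one_pos, fun x y hx h₁ h₂ => ?_⟩
    nlinarith
  have hM0 : 0 < M := hm.trans_le hM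
  have hM' : 0 < M ^ p := rpow_pos_of_pos hM0 p
  refine ⟨min (m ^ p) (M ^ p), max (m ^ p) (M ^ p), lt_min hm' hM', lt_max_of_lt_left hm',
    fun x y hx h₁ h₂ => ?_⟩
  have hxp : 0 ≤ x ^ p := (rpow_pos_of_pos hx p).le
  have hmx : 0 < m * x := mul_pos hm hx
  have hy : 0 < y := hmx.trans_le h₁
  have em : (m * x) ^ p = m ^ p * x ^ p := mul_rpow hm.le hx.le
  have eM : (M * x) ^ p = M ^ p * x ^ p := mul_rpow hM0.le hx.le
  rcases le_total 0 p with hp | hp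
  · have l₁ := rpow_le_rpow hmx.le h₁ hp
    have l₂ := rpow_le_rpow hy.le h₂ hp
    rw [em] at l₁
    rw [eM] at l₂
    exact ⟨(mul_le_mul_of_nonneg_right (min_le_left _ _) hxp).trans l₁,
      l₂.trans (mul_le_mul_of_nonneg_right (le_max_right _ _) hxp)⟩
  · have l₁ := rpow_le_rpow_of_nonpos hmx h₁ hp
    have l₂ := rpow_le_rpow_of_nonpos hy h₂ hp
    rw [em] at l₁
    rw [eM] at l₂
    exact ⟨(mul_le_mul_of_nonneg_right (min_le_right _ _) hxp).trans l₂,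
      l₁.trans (mul_le_mul_of_nonneg_right (le_max_left _ _) hxp)⟩

/-- Away from `π`, the Jacobi density is comparable to a power of `x`. -/
theorem exists_jacobiDensity_comparable (p q : ℝ) :
    ∃ k K : ℝ, 0 < k ∧ 0 < K ∧ ∀ x : ℝ, 0 < x → x ≤ 3 * π / 4 →
      k * x ^ p ≤ sin (x / 2) ^ p * cos (x / 2) ^ q ∧
        sin (x / 2) ^ p * cos (x / 2) ^ q ≤ K * x ^ p := by
  have hπ := pi_pos
  have hc : 0 < cos (3 * π / 8) := cos_pos_of_mem_Ioo ⟨by linarith, by linarith⟩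
  obtain ⟨k₁, K₁, hk₁, hK₁, h₁⟩ := exists_rpow_comparable p (1 / π) (1 / 2) (by positivity)
  obtain ⟨k₂, K₂, hk₂, hK₂, h₂⟩ := exists_rpow_comparable q (cos (3 * π / 8)) 1 hc
  refine ⟨k₁ * k₂, K₁ * K₂, by positivity, by positivity, fun x hx hx' => ?_⟩
  have hs := mul_le_sin (x := x / 2) (by linarith) (by linarith)
  obtain ⟨a₁, a₂⟩ := h₁ x (sin (x / 2)) hx
    (le_trans (le_of_eq (by field_simp)) hs)
    ((sin_lt (x := x / 2) (by linarith)).le.trans (by linarith))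
  obtain ⟨b₁, b₂⟩ := h₂ 1 (cos (x / 2)) one_pos
    (by rw [mul_one]; exact cos_le_cos_of_nonneg_of_le_pi (by linarith) (by linarith) (by linarith))
    (by rw [mul_one]; exact cos_le_one _)
  rw [one_rpow, mul_one] at b₁ b₂
  have hxp : 0 < x ^ p := rpow_pos_of_pos hx p
  constructor
  · calc k₁ * k₂ * x ^ p = (k₁ * x ^ p) * k₂ := by ring
      _ ≤ _ := mul_le_mul a₁ b₁ hk₂.le (le_trans (by positivity) a₁)
  · calc _ ≤ (K₁ * x ^ p) * K₂ := mul_le_mul a₂ b₂ (hk₂.le.trans b₁) (by positivity)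
      _ = _ := by ring

theorem jacobiMeasure_apply (α β : ℝ) {S : Set ℝ} (hS : MeasurableSet S) (hS' : S ⊆ Ioo 0 π) :
    jacobiMeasure α β S =
      ∫⁻ x in S, ENNReal.ofReal (sin (x / 2) ^ (2 * α + 1) * cos (x / 2) ^ (2 * β + 1)) := by
  rw [jacobiMeasure, withDensity_apply _ hS, Measure.restrict_restrict hS,
    inter_eq_self_of_subset_left hS']

/-- Small intervals at the origin satisfy `μ((0,δ]) ≲ δ^{2α+2}`. -/
theorem exists_jacobiMeasure_Ioc_le (α β : ℝ) (hα : -1 < α) :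
    ∃ K : ℝ, 0 < K ∧ ∀ δ : ℝ, 0 < δ → δ ≤ π / 2 →
      jacobiMeasure α β (Ioc 0 δ) ≤ ENNReal.ofReal (K * δ ^ (2 * α + 2)) := by
  obtain ⟨_, K, _, hK, h⟩ := exists_jacobiDensity_comparable (2 * α + 1) (2 * β + 1)
  have hp : 0 < 2 * α + 2 := by linarith
  refine ⟨K / (2 * α + 2), by positivity, fun δ hδ hδ' => ?_⟩
  have hπ := pi_pos
  rw [jacobiMeasure_apply α β measurableSet_Ioc
    fun x hx => ⟨hx.1, by linarith [hx.2]⟩]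
  have hint : IntegrableOn (fun x : ℝ => K * x ^ (2 * α + 1)) (Ioc 0 δ) := by
    rw [← intervalIntegrable_iff_integrableOn_Ioc_of_le hδ.le]
    exact (intervalIntegral.intervalIntegrable_rpow' (by linarith)).const_mul K
  calc _ ≤ ∫⁻ x in Ioc 0 δ, ENNReal.ofReal (K * x ^ (2 * α + 1)) :=
        setLIntegral_mono' measurableSet_Ioc fun x hx =>
          ENNReal.ofReal_le_ofReal (h x hx.1 (by linarith [hx.2])).2
    _ = ENNReal.ofReal (∫ x in Ioc 0 δ, K * x ^ (2 * α + 1)) := by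
        rw [ofReal_integral_eq_lintegral_ofReal hint]
        filter_upwards [ae_restrict_mem measurableSet_Ioc] with x hx
        exact mul_nonneg hK.le (rpow_nonneg hx.1.le _)
    _ = _ := by
        rw [← intervalIntegral.integral_of_le hδ.le, intervalIntegral.integral_const_mul,
          integral_rpow (Or.inl (by linarith)), show 2 * α + 1 + 1 = 2 * α + 2 by ring,
          zero_rpow hp.ne']
        congr 1
        ring

/-- Dyadic-type intervals satisfy `μ((a,3a/2)) ≳ a^{2α+2}`. -/
theorem exists_le_jacobiMeasure_Ioo (α β : ℝ) :
    ∃ k : ℝ, 0 < k ∧ ∀ a : ℝ, 0 < a → a ≤ π / 2 →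
      ENNReal.ofReal (k * a ^ (2 * α + 2)) ≤ jacobiMeasure α β (Ioo a (3 * a / 2)) := by
  obtain ⟨k₁, _, hk₁, _, h₁⟩ := exists_jacobiDensity_comparable (2 * α + 1) (2 * β + 1)
  obtain ⟨k₂, _, hk₂, _, h₂⟩ := exists_rpow_comparable (2 * α + 1) 1 (3 / 2) one_pos
  refine ⟨k₁ * k₂ / 2, by positivity, fun a ha ha' => ?_⟩
  have hπ := pi_pos
  rw [jacobiMeasure_apply α β measurableSet_Ioo
    fun x hx => ⟨ha.trans hx.1, by linarith [hx.2]⟩]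
  calc _ = ∫⁻ _ in Ioo a (3 * a / 2), ENNReal.ofReal (k₁ * (k₂ * a ^ (2 * α + 1))) := by
        rw [setLIntegral_const, Real.volume_Ioo, ← ENNReal.ofReal_mul (by positivity),
          show 2 * α + 2 = 2 * α + 1 + 1 by ring, rpow_add_one ha.ne']
        congr 1
        ring
    _ ≤ _ := setLIntegral_mono' measurableSet_Ioo fun x hx => ENNReal.ofReal_le_ofReal <|
        (mul_le_mul_of_nonneg_left (h₂ a x ha (by linarith [hx.1]) (by linarith [hx.2])).1
          hk₁.le).trans (h₁ x (ha.trans hx.1) (by linarith [hx.2])).1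

theorem measurableSet_jacobiBall (θ r : ℝ) : MeasurableSet (jacobiBall θ r) :=
  measurableSet_Ioo.inter measurableSet_Ioo

/-- The integral in the statement is the Jacobi measure of part of the ball. -/
theorem integral_eq_jacobiMeasure_toReal (α β t θ θ' : ℝ) :
    (∫ η in Ioo (-t) t,
      (if θ + η ∈ Ioo (0 : ℝ) π ∧ θ' + η ≤ 0 then
        (sin ((θ + η) / 2)) ^ (2 * α + 1) * (cos ((θ + η) / 2)) ^ (2 * β + 1)
      else 0)) = (jacobiMeasure α β (jacobiBall θ t ∩ Iic (θ - θ'))).toReal := by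
  set S := jacobiBall θ t ∩ Iic (θ - θ') with hS
  have hSm : MeasurableSet S := (measurableSet_jacobiBall θ t).inter measurableSet_Iic
  have hSπ : S ⊆ Ioo 0 π := fun x hx => hx.1.2
  let w : ℝ → ℝ := fun x => sin (x / 2) ^ (2 * α + 1) * cos (x / 2) ^ (2 * β + 1)
  have hw : Measurable w := by fun_prop
  calc _ = ∫ η, S.indicator w (θ + η) := by
        rw [← integral_indicator measurableSet_Ioo]
        congr 1 with η
        have key : θ + η ∈ S ↔ η ∈ Ioo (-t) t ∧ θ + η ∈ Ioo (0 : ℝ) π ∧ θ' + η ≤ 0 := by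
          simp only [hS, jacobiBall, mem_inter_iff, mem_Ioo, mem_Iic]
          constructor
          · rintro ⟨⟨⟨h₁, h₂⟩, h₃⟩, h₄⟩
            exact ⟨⟨by linarith, by linarith⟩, h₃, by linarith⟩
          · rintro ⟨⟨h₁, h₂⟩, h₃, h₄⟩
            exact ⟨⟨⟨by linarith, by linarith⟩, h₃⟩, by linarith⟩
        by_cases hη : η ∈ Ioo (-t) t
        · by_cases h : θ + η ∈ Ioo (0 : ℝ) π ∧ θ' + η ≤ 0
          · rw [indicator_of_mem hη, if_pos h, indicator_of_mem (key.2 ⟨hη, h⟩)]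
          · rw [indicator_of_mem hη, if_neg h, indicator_of_notMem fun hS => h (key.1 hS).2]
        · rw [indicator_of_notMem hη, indicator_of_notMem fun hS => hη (key.1 hS).1]
    _ = ∫ x in S, w x := by
        rw [integral_add_left_eq_self (S.indicator w) θ, integral_indicator hSm]
    _ = _ := by
        rw [integral_eq_lintegral_of_nonneg_ae _ hw.aestronglyMeasurable,
          jacobiMeasure_apply α β hSm hSπ]
        filter_upwards [ae_restrict_mem hSm] with x hx
        have hx' := hSπ hx
        exact mul_nonneg
          (rpow_nonneg (sin_nonneg_of_nonneg_of_le_pi (by linarith [hx'.1])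
            (by linarith [hx'.1, hx'.2])) _)
          (rpow_nonneg (cos_nonneg_of_mem_Icc ⟨by linarith [hx'.1, hx'.2],
            by linarith [hx'.2]⟩) _)

theorem exists_Ioo_subset_jacobiBall {t θ : ℝ} (ht : t ∈ Ioc 0 π) (hθ : θ ∈ Ioo 0 π)
    (hθt : θ < 2 * t) :
    ∃ a : ℝ, t / 4 ≤ a ∧ a ≤ π / 2 ∧ Ioo a (3 * a / 2) ⊆ jacobiBall θ t := by
  obtain ⟨ht0, htπ⟩ := ht
  obtain ⟨hθ0, hθπ⟩ := hθ
  rcases le_total θ (t / 2) with h | h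
  · refine ⟨t / 4, le_rfl, by linarith, fun x hx => ?_⟩
    obtain ⟨h₁, h₂⟩ := hx
    exact ⟨⟨by linarith, by linarith⟩, by linarith, by linarith⟩
  · refine ⟨θ / 2, by linarith, by linarith, fun x hx => ?_⟩
    obtain ⟨h₁, h₂⟩ := hx
    exact ⟨⟨by linarith, by linarith⟩, by linarith, by linarith⟩

theorem stmt_13 (α β : ℝ) (hα : -1 < α) (hβ : -1 < β) :
    ∃ C : ℝ, 0 < C ∧
      ∀ t : ℝ, t ∈ Ioc (0 : ℝ) π → ∀ θ ∈ Ioo (0 : ℝ) π, ∀ θ' ∈ Ioo (0 : ℝ) π,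
        |θ - θ'| ≤ t →
          (1 / V α β t θ) *
            (∫ η in Ioo (-t) t,
              (if θ + η ∈ Ioo (0 : ℝ) π ∧ θ' + η ≤ 0 then
                (Real.sin ((θ + η) / 2)) ^ (2 * α + 1) * (Real.cos ((θ + η) / 2)) ^ (2 * β + 1)
              else 0))
            ≤ C * (|θ - θ'| / t) ^ (2 * α + 2) := by
  have hp : 0 < 2 * α + 2 := by linarith
  obtain ⟨K, hK, hupper⟩ := exists_jacobiMeasure_Ioc_le α β hα
  obtain ⟨k, hk, hlower⟩ := exists_le_jacobiMeasure_Ioo α β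
  have h2 : 0 < (2 : ℝ) ^ (2 * α + 2) := by positivity
  have h4 : 0 < (4 : ℝ) ^ (2 * α + 2) := by positivity
  refine ⟨2 ^ (2 * α + 2) + K / k * 4 ^ (2 * α + 2), by positivity,
    fun t ht θ hθ θ' hθ' hd => ?_⟩
  have hr : 0 ≤ (|θ - θ'| / t) ^ (2 * α + 2) :=
    rpow_nonneg (div_nonneg (abs_nonneg _) ht.1.le) _
  have hrhs : 0 ≤ (2 ^ (2 * α + 2) + K / k * 4 ^ (2 * α + 2)) *
      (|θ - θ'| / t) ^ (2 * α + 2) := mul_nonneg (by positivity) hr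
  rw [integral_eq_jacobiMeasure_toReal, V]
  set B := jacobiBall θ t
  set S := B ∩ Iic (θ - θ')
  rcases S.eq_empty_or_nonempty with hS | ⟨x, ⟨⟨hxt, -⟩, hx0, -⟩, hxd⟩
  · simpa [hS] using hrhs
  by_cases hB : jacobiMeasure α β B = ⊤
  · simpa [hB] using hrhs
  have hxd' : x ≤ θ - θ' := hxd
  have hδ : 0 < θ - θ' := hx0.trans_le hxd'
  rw [abs_of_pos hδ] at hd hr hrhs ⊢
  have ht0 := ht.1
  have htπ := ht.2
  rw [one_div_mul_eq_div]
  rcases le_or_gt t (2 * (θ - θ')) with h | h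
  · have hle : (jacobiMeasure α β S).toReal ≤ (jacobiMeasure α β B).toReal :=
      ENNReal.toReal_mono hB (measure_mono inter_subset_left)
    have hone : (1 : ℝ) ≤ 2 ^ (2 * α + 2) * ((θ - θ') / t) ^ (2 * α + 2) := by
      rw [← mul_rpow two_pos.le (by positivity)]
      refine one_le_rpow ?_ hp.le
      rw [← mul_div_assoc, le_div_iff₀ ht0, one_mul]
      exact h
    calc _ ≤ (1 : ℝ) := div_le_one_of_le₀ hle ENNReal.toReal_nonneg
      _ ≤ _ := hone
      _ ≤ _ := mul_le_mul_of_nonneg_right (le_add_of_nonneg_right (by positivity)) hr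
  · obtain ⟨a, hta, haπ, hsub⟩ := exists_Ioo_subset_jacobiBall ht hθ (by linarith)
    have ha : 0 < a := by linarith
    have hSδ : S ⊆ Ioc 0 (θ - θ') := fun y hy => ⟨hy.1.2.1, hy.2⟩
    have hN : (jacobiMeasure α β S).toReal ≤ K * (θ - θ') ^ (2 * α + 2) :=
      ENNReal.toReal_le_of_le_ofReal (by positivity) <|
        (measure_mono hSδ).trans (hupper _ hδ (by linarith))
    have hV : k * (t / 4) ^ (2 * α + 2) ≤ (jacobiMeasure α β B).toReal := by
      refine le_trans ?_ ((ENNReal.ofReal_le_iff_le_toReal hB).1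
        ((hlower a ha haπ).trans (measure_mono hsub)))
      exact mul_le_mul_of_nonneg_left (rpow_le_rpow (by positivity) hta hp.le) hk.le
    calc _ ≤ (K * (θ - θ') ^ (2 * α + 2)) / (k * (t / 4) ^ (2 * α + 2)) :=
          div_le_div₀ (by positivity) hN (by positivity) hV
      _ = K / k * 4 ^ (2 * α + 2) * ((θ - θ') / t) ^ (2 * α + 2) := by
          rw [div_rpow ht0.le (by norm_num), div_rpow hδ.le ht0.le]
          field_simp
      _ ≤ _ := mul_le_mul_of_nonneg_right (le_add_of_nonneg_left h2.le) hr
end
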